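/- Let A be a commutative ring and f ∈ A a non-zero-divisor. Let φ : A → B be an A-algebra such that B is f-torsion free and such that the induced map A/fA → B/fB is an isomorphism. Then A is completely integrally closed in A[1/f] if and only if B is completely integrally closed in B[1/f]. -/

import Mathlib

/-- A ring `B` is `g`-torsion free if the only element killed by a positive power
of `g` is zero. -/
def FTorsionFree {B : Type*} [CommRing B] (g : B) : Prop :=
  ∀ x : B, (∃ n : ℕ, 1 ≤ n ∧ g ^ n * x = 0) → x = 0

/-- `b : B` is almost integral over `A` (along `φ : A → B`): all powers of `b`
lie in the `A`-span of some finite subset of `B`. -/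
def AlmostIntegralElem {A B : Type*} [CommRing A] [CommRing B] (φ : A →+* B)
    (b : B) : Prop :=
  ∃ s : Finset B, ∀ n : ℕ, ∃ c : B → A, b ^ n = ∑ x ∈ s, φ (c x) * x

/-- `A` is completely integrally closed in `B` (along `φ : A → B`). -/
def CompletelyIntegrallyClosedIn {A B : Type*} [CommRing A] [CommRing B]
    (φ : A →+* B) : Prop :=
  ∀ b : B, AlmostIntegralElem φ b → ∃ a : A, φ a = b

/-- For a non-zero-divisor `g`, complete integral closedness of `R` in `R[1/g]` expressed
through divisibility by powers of `g` in `R`. -/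
theorem completelyIntegrallyClosedIn_away_iff {R : Type*} [CommRing R] {g : R}
    (hg : g ∈ nonZeroDivisors R) :
    CompletelyIntegrallyClosedIn (algebraMap R (Localization.Away g)) ↔
      ∀ (a : R) (k m : ℕ), (∀ n : ℕ, g ^ (k * n) ∣ g ^ m * a ^ n) → g ^ k ∣ a := by
  have inj : Function.Injective (algebraMap R (Localization.Away g)) :=
    IsLocalization.injective _ (Submonoid.powers_le.mpr hg)
  set ι := algebraMap R (Localization.Away g)
  obtain ⟨u, hu⟩ : ∃ u, ι g * u = 1 :=
    isUnit_iff_exists_inv.mp (IsLocalization.Away.algebraMap_isUnit g)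
  have hup (j : ℕ) : ι g ^ j * u ^ j = 1 := by rw [← mul_pow, hu, one_pow]
  constructor
  · intro h a k m hd
    obtain ⟨r, hr⟩ := h (ι a * u ^ k) ⟨{u ^ m}, fun n ↦ by
      obtain ⟨c, hc⟩ := hd n
      refine ⟨fun _ ↦ c, ?_⟩
      have hc' : ι g ^ m * ι a ^ n = ι g ^ (k * n) * ι c := by
        simpa only [map_mul, map_pow] using congrArg ι hc
      rw [Finset.sum_singleton, mul_pow, ← pow_mul]
      linear_combination (u ^ (k * n) * u ^ m) * hc' - ι a ^ n * u ^ (k * n) * hup m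
        + ι c * u ^ m * hup (k * n)⟩
    refine ⟨r, inj ?_⟩
    rw [map_mul, map_pow, hr]
    linear_combination -ι a * hup k
  · rintro h b ⟨s, hs⟩
    obtain ⟨⟨_, m, rfl⟩, hm⟩ :=
      IsLocalization.exist_integer_multiples_of_finset (Submonoid.powers g) s
    obtain ⟨k, a, hk⟩ := IsLocalization.Away.surj g b
    obtain ⟨r, rfl⟩ := h a k m fun n ↦ by
      obtain ⟨c, hc⟩ := hs n
      choose! y hy using hm
      refine ⟨∑ x ∈ s, c x * y x, inj ?_⟩
      have hsum : ι g ^ m * b ^ n = ι (∑ x ∈ s, c x * y x) := by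
        rw [hc, map_sum, Finset.mul_sum]
        refine Finset.sum_congr rfl fun x hx ↦ ?_
        have hyx : ι (y x) = ι g ^ m * x := by
          rw [← map_pow]
          exact (hy x hx).trans (Algebra.smul_def _ _)
        rw [map_mul, hyx]
        ring
      rw [map_mul, map_mul, ← hsum, map_pow, map_pow, map_pow, ← hk, mul_pow, ← pow_mul]
      ring
    refine ⟨r, ?_⟩
    rw [map_mul, map_pow] at hk
    linear_combination -u ^ k * hk + (b - ι r) * hup k

/-- If `φ` induces an injection `A/fA → B/fB`, then it induces injections
`A/fᵏA → B/fᵏB`. -/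
theorem pow_dvd_of_map_pow_dvd {A B : Type*} [CommRing A] [CommRing B] {φ : A →+* B} {f : A}
    (hf : φ f ∈ nonZeroDivisors B) (hinj : ∀ a : A, φ f ∣ φ a → f ∣ a) (k : ℕ) :
    ∀ a : A, φ f ^ k ∣ φ a → f ^ k ∣ a := by
  induction k with
  | zero => simp
  | succ k ih =>
    rintro a ⟨b, hb⟩
    obtain ⟨a, rfl⟩ := hinj a ⟨φ f ^ k * b, by rw [hb]; ring⟩
    rw [pow_succ']
    refine mul_dvd_mul_left f (ih a ⟨b, (mul_cancel_left_mem_nonZeroDivisors hf).mp ?_⟩)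
    rw [← map_mul, hb]
    ring

/-- If `φ` induces a surjection `A/fA → B/fB`, then it induces surjections
`A/fᵏA → B/fᵏB`. -/
theorem exists_eq_map_add_pow_mul {A B : Type*} [CommRing A] [CommRing B] {φ : A →+* B} {f : A}
    (hsurj : ∀ b : B, ∃ a : A, ∃ b' : B, b = φ a + φ f * b') (k : ℕ) (b : B) :
    ∃ a : A, ∃ b' : B, b = φ a + φ f ^ k * b' := by
  induction k with
  | zero => exact ⟨0, b, by simp⟩
  | succ k ih =>
    obtain ⟨a, b', hb⟩ := ih
    obtain ⟨a', c, hc⟩ := hsurj b'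
    refine ⟨a + f ^ k * a', c, ?_⟩
    rw [hb, hc, map_add, map_mul, map_pow]
    ring

/-- If `b / q` is almost integral with denominator `d`, then so is `b / q + c`. -/
theorem pow_dvd_mul_add_mul_pow {R : Type*} [CommRing R] {q d b : R}
    (h : ∀ n : ℕ, q ^ n ∣ d * b ^ n) (c : R) (n : ℕ) : q ^ n ∣ d * (b + q * c) ^ n := by
  rw [add_pow, Finset.mul_sum]
  refine Finset.dvd_sum fun i hi ↦ ?_
  have hin : i + (n - i) = n := by
    have := Finset.mem_range.mp hi
    lia
  calc q ^ n = q ^ i * q ^ (n - i) := by rw [← pow_add, hin]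
    _ ∣ d * b ^ i * q ^ (n - i) := mul_dvd_mul_right (h i) _
    _ ∣ d * (b ^ i * (q * c) ^ (n - i) * (n.choose i)) :=
      ⟨c ^ (n - i) * n.choose i, by rw [mul_pow]; ring⟩

/-- Let `f ∈ A` be a non-zero-divisor and `φ : A → B` an
`f`-torsion-free `A`-algebra inducing an isomorphism `A/fA ≃ B/fB`. Then `A` is
completely integrally closed in `A[1/f]` iff `B` is completely integrally closed
in `B[1/f]`. -/
theorem stmt6 {A B : Type*} [CommRing A] [CommRing B] (φ : A →+* B) (f : A)
    (hf : f ∈ nonZeroDivisors A) (hB : FTorsionFree (φ f))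
    -- `A/fA → B/fB` is injective …
    (hinj : ∀ a : A, (∃ b : B, φ a = φ f * b) → ∃ a' : A, a = f * a')
    -- … and surjective (hence an isomorphism)
    (hsurj : ∀ b : B, ∃ a : A, ∃ b' : B, b = φ a + φ f * b') :
    CompletelyIntegrallyClosedIn (algebraMap A (Localization.Away f)) ↔
      CompletelyIntegrallyClosedIn (algebraMap B (Localization.Away (φ f))) := by
  have hφf : φ f ∈ nonZeroDivisors B :=
    mem_nonZeroDivisors_iff_right.mpr fun x hx ↦ hB x ⟨1, le_rfl, by rw [pow_one, mul_comm, hx]⟩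
  rw [completelyIntegrallyClosedIn_away_iff hf, completelyIntegrallyClosedIn_away_iff hφf]
  have hdvd := pow_dvd_of_map_pow_dvd hφf hinj
  constructor
  · intro h b k m hb
    obtain ⟨a, b', rfl⟩ := exists_eq_map_add_pow_mul hsurj k b
    have ha : f ^ k ∣ a := h a k m fun n ↦ hdvd _ _ <| by
      simp only [pow_mul] at hb ⊢
      simpa using pow_dvd_mul_add_mul_pow hb (-b') n
    exact dvd_add (by simpa using map_dvd φ ha) (dvd_mul_right _ _)
  · intro h a k m ha
    exact hdvd k a <| h (φ a) k m fun n ↦ by simpa using map_dvd φ (ha n)
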